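/- Let s_{11}, s_{12}, s_{13}, s_{21}, s_{22}, s_{31}, z be complex numbers, all with real part greater than 1. For an ordered 6-tuple (a_1,…,a_6) define F(a_1,…,a_6) = ζ_{(3,2,1)}(rows (a_1,a_2,a_3), (a_4,a_5), (s_{31})) · ζ(a_6), and G(a_1,…,a_6) = ζ_{(3,2,1,1)}(rows (a_6,a_2,a_3), (a_1,a_5), (a_4), (s_{31})) + ζ_{(3,2,2)}(rows (a_1,a_6,a_3), (a_4,a_2), (s_{31},a_5)) + ζ_{(3,3,1)}(rows (a_1,a_2,a_6), (a_4,a_5,a_3), (s_{31})) + ζ_{(4,2,1)}(rows (a_1,a_2,a_3,a_6), (a_4,a_5), (s_{31})). Then the sum of F over all 720 orderings (a_1,…,a_6) of the 6-tuple (s_{11}, s_{12}, s_{13}, s_{21}, s_{22}, z) equals the sum of G over the same 720 orderings. -/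

import Mathlib

open scoped BigOperators

/-- The multiple zeta function `ζ(s₁,…,s_r) = Σ_{0<n₁<⋯<n_r} Π nᵢ^{-sᵢ}`
(equal to `1` for the empty tuple). -/
noncomputable def MZV (s : List ℂ) : ℂ :=
  ∑' n : {f : Fin s.length → ℕ+ // StrictMono f},
    ∏ i : Fin s.length, (n.1 i : ℂ) ^ (-(s.get i))

/-- The multiple zeta-star function `ζ⋆(s₁,…,s_r) = Σ_{0<n₁≤⋯≤n_r} Π nᵢ^{-sᵢ}`
(equal to `1` for the empty tuple). -/
noncomputable def MZSV (s : List ℂ) : ℂ :=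
  ∑' n : {f : Fin s.length → ℕ+ // Monotone f},
    ∏ i : Fin s.length, (n.1 i : ℂ) ^ (-(s.get i))

/-- The Schur multiple zeta function of shape `μ` with (0-indexed) filling `s`.
Mathlib's semistandard Young tableaux have entries in `ℕ = {0,1,2,…}`, so the entry is
shifted by `1` to make it range over the positive integers. -/
noncomputable def schurZeta (μ : YoungDiagram) (s : ℕ → ℕ → ℂ) : ℂ :=
  ∑' T : SemistandardYoungTableau μ,
    ∏ c ∈ μ.cells, (((T c.1 c.2 + 1 : ℕ) : ℂ)) ^ (-(s c.1 c.2))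

/-- A filling of a Young diagram given by its list of rows (0 outside). -/
def fillOfRows (rows : List (List ℂ)) : ℕ → ℕ → ℂ := fun i j => (rows.getD i []).getD j 0

/-- `F(a₁,…,a₆)` : the Schur multiple zeta value of shape `(3,2,1)` with rows
`(a₁,a₂,a₃)`, `(a₄,a₅)`, `(s₃₁)`, multiplied by `ζ(a₆)`. -/
noncomputable def F13 (s31 a1 a2 a3 a4 a5 a6 : ℂ) : ℂ :=
  schurZeta (YoungDiagram.ofRowLens [3, 2, 1] (by decide))
      (fillOfRows [[a1, a2, a3], [a4, a5], [s31]])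
    * MZV [a6]

/-- `G(a₁,…,a₆)` : the sum of the four Schur multiple zeta values obtained by the
pushing rule: shapes `(3,2,1,1)`, `(3,2,2)`, `(3,3,1)` and `(4,2,1)`. -/
noncomputable def G13 (s31 a1 a2 a3 a4 a5 a6 : ℂ) : ℂ :=
  schurZeta (YoungDiagram.ofRowLens [3, 2, 1, 1] (by decide))
    (fillOfRows [[a6, a2, a3], [a1, a5], [a4], [s31]])
  + schurZeta (YoungDiagram.ofRowLens [3, 2, 2] (by decide))
    (fillOfRows [[a1, a6, a3], [a4, a2], [s31, a5]])
  + schurZeta (YoungDiagram.ofRowLens [3, 3, 1] (by decide))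
    (fillOfRows [[a1, a2, a6], [a4, a5, a3], [s31]])
  + schurZeta (YoungDiagram.ofRowLens [4, 2, 1] (by decide))
    (fillOfRows [[a1, a2, a3, a6], [a4, a5], [s31]])

/-- The labellings of the cells `e 0, …, e (n - 1)` that increase weakly along rows and strictly
down columns. -/
def tableauSet {n : ℕ} (e : Fin n → ℕ × ℕ) : Set (Fin n → ℕ) :=
  {v | (∀ p q, (e p).1 = (e q).1 → (e p).2 < (e q).2 → v p ≤ v q) ∧
    ∀ p q, (e p).2 = (e q).2 → (e p).1 < (e q).1 → v p < v q}

/-- The monomial `Π (vᵢ + 1)^{-tᵢ}`. -/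
noncomputable def zetaTerm {n : ℕ} (t : Fin n → ℂ) (v : Fin n → ℕ) : ℂ :=
  ∏ i, ((v i + 1 : ℕ) : ℂ) ^ (-(t i))

/-- Semistandard tableaux of shape `μ` as labellings of an enumeration of the cells of `μ`. -/
noncomputable def tableauEquiv {n : ℕ} (μ : YoungDiagram) (e : Fin n → ℕ × ℕ)
    (he : Function.Injective e) (hμ : μ.cells = Finset.univ.image e) :
    SemistandardYoungTableau μ ≃ tableauSet e where
  toFun T := ⟨fun i => T (e i).1 (e i).2, by
    have hmem : ∀ p, e p ∈ μ := fun p => by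
      rw [← YoungDiagram.mem_cells, hμ]; simp
    refine ⟨fun p q h1 h2 => ?_, fun p q h1 h2 => ?_⟩
    · have := T.row_weak (i := (e q).1) h2 (hmem q)
      simpa [h1] using this
    · have := T.col_strict (j := (e q).2) h2 (hmem q)
      simpa [h1] using this⟩
  invFun v :=
    { entry := fun i j => Function.extend e v.1 0 (i, j)
      row_weak' := by
        intro i j1 j2 h hc
        have hc1 : (i, j1) ∈ μ := μ.up_left_mem le_rfl h.le hc
        rw [← YoungDiagram.mem_cells, hμ] at hc hc1
        obtain ⟨q, -, hq⟩ := Finset.mem_image.1 hc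
        obtain ⟨p, -, hp⟩ := Finset.mem_image.1 hc1
        rw [← hq, ← hp, he.extend_apply, he.extend_apply]
        exact v.2.1 p q (by rw [hp, hq]) (by rw [hp, hq]; exact h)
      col_strict' := by
        intro i1 i2 j h hc
        have hc1 : (i1, j) ∈ μ := μ.up_left_mem h.le le_rfl hc
        rw [← YoungDiagram.mem_cells, hμ] at hc hc1
        obtain ⟨q, -, hq⟩ := Finset.mem_image.1 hc
        obtain ⟨p, -, hp⟩ := Finset.mem_image.1 hc1
        rw [← hq, ← hp, he.extend_apply, he.extend_apply]
        exact v.2.2 p q (by rw [hp, hq]) (by rw [hp, hq]; exact h)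
      zeros' := by
        intro i j h
        rw [← YoungDiagram.mem_cells, hμ] at h
        rw [Function.extend_apply']
        · rfl
        · rintro ⟨p, hp⟩
          exact h (Finset.mem_image.2 ⟨p, Finset.mem_univ _, hp⟩) }
  left_inv T := by
    ext i j
    change Function.extend e (fun i => T (e i).1 (e i).2) 0 (i, j) = T i j
    by_cases h : ∃ p, e p = (i, j)
    · obtain ⟨p, hp⟩ := h
      rw [← hp, he.extend_apply, hp]
    · rw [Function.extend_apply' _ _ _ h, T.zeros]
      · rfl
      · rw [← YoungDiagram.mem_cells, hμ]
        simpa using h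
  right_inv v := by
    ext p
    exact he.extend_apply v.1 0 p

theorem schurZeta_eq_tsum_indicator {n : ℕ} (μ : YoungDiagram) (s : ℕ → ℕ → ℂ)
    (e : Fin n → ℕ × ℕ) (he : Function.Injective e) (hμ : μ.cells = Finset.univ.image e) :
    schurZeta μ s =
      ∑' v, (tableauSet e).indicator (zetaTerm fun i => s (e i).1 (e i).2) v := by
  rw [← tsum_subtype, ← (tableauEquiv μ e he hμ).tsum_eq, schurZeta]
  refine tsum_congr fun T => ?_
  rw [hμ, Finset.prod_image he.injOn]
  rfl

theorem summable_norm_prod_apply {n : ℕ} (f : Fin n → ℕ → ℂ)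
    (h : ∀ i, Summable fun k => ‖f i k‖) :
    Summable fun v : Fin n → ℕ => ‖∏ i, f i (v i)‖ := by
  induction n with
  | zero => exact .of_finite
  | succ n ih =>
    rw [← (Fin.consEquiv fun _ => ℕ).summable_iff]
    have := Summable.mul_of_nonneg (h 0) (ih (fun i => f i.succ) fun i => h i.succ)
      (fun _ => norm_nonneg _) fun _ => norm_nonneg _
    refine this.congr fun x => ?_
    simp [Fin.prod_univ_succ, Fin.consEquiv]

theorem summable_norm_succ_cpow {s : ℂ} (h : 1 < s.re) :
    Summable fun k : ℕ => ‖((k + 1 : ℕ) : ℂ) ^ (-s)‖ := by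
  have := (summable_nat_add_iff 1).2 (Complex.summable_one_div_nat_cpow.2 h).norm
  refine this.congr fun k => ?_
  rw [Complex.cpow_neg, one_div]

theorem summable_norm_zetaTerm {n : ℕ} {t : Fin n → ℂ} (h : ∀ i, 1 < (t i).re) :
    Summable fun v => ‖zetaTerm t v‖ :=
  summable_norm_prod_apply (fun i k => ((k + 1 : ℕ) : ℂ) ^ (-(t i)))
    fun i => summable_norm_succ_cpow (h i)

theorem summable_zetaTerm {n : ℕ} {t : Fin n → ℂ} (h : ∀ i, 1 < (t i).re) :
    Summable (zetaTerm t) :=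
  (summable_norm_zetaTerm h).of_norm

theorem MZV_singleton (a : ℂ) : MZV [a] = ∑' k : ℕ, ((k + 1 : ℕ) : ℂ) ^ (-a) := by
  let E : {f : Fin [a].length → ℕ+ // StrictMono f} ≃ ℕ :=
    { toFun := fun f => (f.1 0).natPred
      invFun := fun k => ⟨fun _ => k.succPNat, Subsingleton.strictMono (α := Fin 1) _⟩
      left_inv := fun f => by
        ext i
        rw [Subsingleton.elim (α := Fin 1) i 0]
        simp
      right_inv := fun k => by simp }
  rw [MZV, ← E.tsum_eq]
  refine tsum_congr fun f => ?_
  have : (f.1 0).natPred + 1 = (f.1 0 : ℕ) := PNat.natPred_add_one _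
  change _ = (((f.1 0).natPred + 1 : ℕ) : ℂ) ^ (-a)
  rw [this]
  exact Fin.prod_univ_one _

theorem tsum_indicator_mul_tsum {n : ℕ} (t : Fin n → ℂ) (a : ℂ) (S : Set (Fin n → ℕ))
    (ht : ∀ i, 1 < (t i).re) (ha : 1 < a.re) :
    (∑' v, S.indicator (zetaTerm t) v) * ∑' k : ℕ, ((k + 1 : ℕ) : ℂ) ^ (-a) =
      ∑' v, {v : Fin (n + 1) → ℕ | (fun i => v i.castSucc) ∈ S}.indicator
        (zetaTerm (Fin.snoc t a)) v := by
  have hS : Summable fun v => ‖S.indicator (zetaTerm t) v‖ := by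
    simpa only [norm_indicator_eq_indicator_norm] using (summable_norm_zetaTerm ht).indicator S
  rw [mul_comm, tsum_mul_tsum_of_summable_norm (summable_norm_succ_cpow ha) hS,
    ← (Fin.snocEquiv fun _ => ℕ).tsum_eq]
  refine tsum_congr fun x => ?_
  obtain ⟨k, v⟩ := x
  by_cases hv : v ∈ S <;>
    simp [Set.indicator, hv, zetaTerm, Fin.prod_univ_castSucc, Fin.snocEquiv, mul_comm]

/-- The labellings of the cells of `(3,2,1)` (cell `(2,0)` first), with a free seventh label. -/
def freeSet : Set (Fin 7 → ℕ) :=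
  {v | v 1 ≤ v 2 ∧ v 2 ≤ v 3 ∧ v 4 ≤ v 5 ∧ v 1 < v 4 ∧ v 2 < v 5 ∧ v 4 < v 0}

/-- Tableaux with rows `(v₆,v₂,v₃)`, `(v₁,v₅)`, `(v₄)`, `(v₀)`. -/
def firstColumnSet : Set (Fin 7 → ℕ) :=
  {v | v 6 ≤ v 2 ∧ v 2 ≤ v 3 ∧ v 1 ≤ v 5 ∧ v 6 < v 1 ∧ v 1 < v 4 ∧ v 4 < v 0 ∧ v 2 < v 5}

/-- Tableaux with rows `(v₁,v₆,v₃)`, `(v₄,v₂)`, `(v₀,v₅)`. -/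
def secondColumnSet : Set (Fin 7 → ℕ) :=
  {v | v 1 ≤ v 6 ∧ v 6 ≤ v 3 ∧ v 4 ≤ v 2 ∧ v 0 ≤ v 5 ∧ v 1 < v 4 ∧ v 4 < v 0 ∧ v 6 < v 2 ∧
    v 2 < v 5}

/-- Tableaux with rows `(v₁,v₂,v₆)`, `(v₄,v₅,v₃)`, `(v₀)`. -/
def thirdColumnSet : Set (Fin 7 → ℕ) :=
  {v | v 1 ≤ v 2 ∧ v 2 ≤ v 6 ∧ v 4 ≤ v 5 ∧ v 5 ≤ v 3 ∧ v 1 < v 4 ∧ v 4 < v 0 ∧ v 2 < v 5 ∧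
    v 6 < v 3}

/-- Tableaux with rows `(v₁,v₂,v₃,v₆)`, `(v₄,v₅)`, `(v₀)`. -/
def fourthColumnSet : Set (Fin 7 → ℕ) :=
  {v | v 1 ≤ v 2 ∧ v 2 ≤ v 3 ∧ v 3 ≤ v 6 ∧ v 4 ≤ v 5 ∧ v 1 < v 4 ∧ v 4 < v 0 ∧ v 2 < v 5}

theorem F13_eq_tsum (s31 a1 a2 a3 a4 a5 a6 : ℂ)
    (h : ∀ i, 1 < (![s31, a1, a2, a3, a4, a5, a6] i).re) :
    F13 s31 a1 a2 a3 a4 a5 a6 =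
      ∑' v, freeSet.indicator (zetaTerm ![s31, a1, a2, a3, a4, a5, a6]) v := by
  have h' := h
  simp only [Fin.forall_fin_succ] at h'
  simp at h'
  have free_eq : {v : Fin 7 → ℕ | (fun i => v i.castSucc) ∈
      tableauSet ![(2, 0), (0, 0), (0, 1), (0, 2), (1, 0), (1, 1)]} = freeSet := by
    ext v
    simp [freeSet, tableauSet, Fin.forall_fin_succ]
    omega
  rw [F13, schurZeta_eq_tsum_indicator _ _ ![(2, 0), (0, 0), (0, 1), (0, 2), (1, 0), (1, 1)]
    (by decide) (by decide), MZV_singleton, tsum_indicator_mul_tsum]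
  · congr 1
    rw [free_eq]
    congr 2
  · simp [Fin.forall_fin_succ, fillOfRows, h']
  · tauto

theorem tableauSet_eq_firstColumnSet :
    tableauSet ![(3, 0), (1, 0), (0, 1), (0, 2), (2, 0), (1, 1), (0, 0)] = firstColumnSet := by
  ext v
  simp [firstColumnSet, tableauSet, Fin.forall_fin_succ]
  omega

theorem tableauSet_eq_secondColumnSet :
    tableauSet ![(2, 0), (0, 0), (1, 1), (0, 2), (1, 0), (2, 1), (0, 1)] = secondColumnSet := by
  ext v
  simp [secondColumnSet, tableauSet, Fin.forall_fin_succ]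
  omega

theorem tableauSet_eq_thirdColumnSet :
    tableauSet ![(2, 0), (0, 0), (0, 1), (1, 2), (1, 0), (1, 1), (0, 2)] = thirdColumnSet := by
  ext v
  simp [thirdColumnSet, tableauSet, Fin.forall_fin_succ]
  omega

theorem tableauSet_eq_fourthColumnSet :
    tableauSet ![(2, 0), (0, 0), (0, 1), (0, 2), (1, 0), (1, 1), (0, 3)] = fourthColumnSet := by
  ext v
  simp [fourthColumnSet, tableauSet, Fin.forall_fin_succ]
  omega

theorem G13_eq_tsum (s31 a1 a2 a3 a4 a5 a6 : ℂ) :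
    G13 s31 a1 a2 a3 a4 a5 a6 =
      ∑' v, firstColumnSet.indicator (zetaTerm ![s31, a1, a2, a3, a4, a5, a6]) v
      + ∑' v, secondColumnSet.indicator (zetaTerm ![s31, a1, a2, a3, a4, a5, a6]) v
      + ∑' v, thirdColumnSet.indicator (zetaTerm ![s31, a1, a2, a3, a4, a5, a6]) v
      + ∑' v, fourthColumnSet.indicator (zetaTerm ![s31, a1, a2, a3, a4, a5, a6]) v := by
  rw [G13, schurZeta_eq_tsum_indicator _ _
      ![(3, 0), (1, 0), (0, 1), (0, 2), (2, 0), (1, 1), (0, 0)] (by decide) (by decide),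
    schurZeta_eq_tsum_indicator _ _
      ![(2, 0), (0, 0), (1, 1), (0, 2), (1, 0), (2, 1), (0, 1)] (by decide) (by decide),
    schurZeta_eq_tsum_indicator _ _
      ![(2, 0), (0, 0), (0, 1), (1, 2), (1, 0), (1, 1), (0, 2)] (by decide) (by decide),
    schurZeta_eq_tsum_indicator _ _
      ![(2, 0), (0, 0), (0, 1), (0, 2), (1, 0), (1, 1), (0, 3)] (by decide) (by decide),
    tableauSet_eq_firstColumnSet, tableauSet_eq_secondColumnSet, tableauSet_eq_thirdColumnSet,
    tableauSet_eq_fourthColumnSet]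
  congr! 4

/-- The sum of the monomials over all orderings of the exponents other than the first one. -/
noncomputable def symmTerm {n : ℕ} (s : ℂ) (a : Fin n → ℂ) (v : Fin (n + 1) → ℕ) : ℂ :=
  ∑ σ : Equiv.Perm (Fin n), zetaTerm (Fin.cons s (a ∘ σ)) v

theorem symmTerm_comp {n : ℕ} (s : ℂ) (a : Fin n → ℂ) (π : Equiv.Perm (Fin (n + 1)))
    (hπ : π 0 = 0) (v : Fin (n + 1) → ℕ) : symmTerm s a (v ∘ π) = symmTerm s a v := by
  obtain ⟨⟨p, τ⟩, rfl⟩ := Equiv.Perm.decomposeFin.symm.surjective π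
  obtain rfl : p = 0 := by simpa using hπ
  refine Fintype.sum_equiv (Equiv.mulRight τ⁻¹) _ _ fun σ => ?_
  simp only [zetaTerm, Fin.prod_univ_succ, Fin.cons_zero, Fin.cons_succ, Function.comp_apply, hπ]
  congr 1
  refine Fintype.prod_equiv τ _ _ fun i => ?_
  simp

theorem tsum_indicator_comp {W : (Fin 7 → ℕ) → ℂ} (π : Equiv.Perm (Fin 7))
    (hW : ∀ v, W (v ∘ π) = W v) (S : Set (Fin 7 → ℕ)) :
    ∑' v, S.indicator W v = ∑' v, {v | v ∘ π ∈ S}.indicator W v := by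
  rw [← (π.symm.arrowCongr (Equiv.refl ℕ)).tsum_eq]
  refine tsum_congr fun v => ?_
  change S.indicator W (v ∘ π) = _
  simp only [Set.indicator, hW, Set.mem_ofPred_eq]

theorem summable_zetaTerm_cons {n : ℕ} (s : ℂ) (a : Fin n → ℂ) (hs : 1 < s.re)
    (ha : ∀ i, 1 < (a i).re) (σ : Equiv.Perm (Fin n)) :
    Summable (zetaTerm (Fin.cons s (a ∘ σ))) :=
  summable_zetaTerm (Fin.cases (by simpa) fun i => by simpa using ha (σ i))

theorem tsum_indicator_union_eq_sum {α : Type*} {W : α → ℂ} (hs : Summable W)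
    (L : List (Set α)) (hd : L.Pairwise Disjoint) :
    ∑' v, (L.foldr (· ∪ ·) ∅).indicator W v = (L.map fun S => ∑' v, S.indicator W v).sum := by
  induction L with
  | nil => simp
  | cons S L ih =>
    obtain ⟨hS, hL⟩ := List.pairwise_cons.1 hd
    have hdisj : Disjoint S (L.foldr (· ∪ ·) ∅) := by
      clear ih hd hL
      induction L with
      | nil => simp
      | cons T L ih =>
        exact Set.disjoint_union_right.2
          ⟨hS T (by simp), ih fun U hU => hS U (List.mem_cons_of_mem _ hU)⟩
    rw [List.foldr_cons, Set.indicator_union_of_disjoint hdisj, List.map_cons, List.sum_cons,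
      Summable.tsum_add (hs.indicator _) (hs.indicator _), ih hL]

/-- Row insertion of the seventh label bumps `v₂`, `v₅` and then appends `v₅` to the third row. -/
def bumpSecondAppendThirdSet : Set (Fin 7 → ℕ) :=
  {v | v ∈ freeSet ∧ v 6 < v 2 ∧ v 1 ≤ v 6 ∧ v 4 ≤ v 2 ∧ v 0 ≤ v 5}

/-- Row insertion of the seventh label bumps `v₃`, `v₅` and then appends `v₅` to the third row. -/
def bumpThirdAppendThirdSet : Set (Fin 7 → ℕ) :=
  {v | v ∈ freeSet ∧ v 6 < v 3 ∧ v 2 ≤ v 6 ∧ v 3 < v 5 ∧ v 4 ≤ v 3 ∧ v 0 ≤ v 5}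

/-- Row insertion of the seventh label bumps `v₃`, `v₅` and `v₀`. -/
def bumpThirdSecondSet : Set (Fin 7 → ℕ) :=
  {v | v ∈ freeSet ∧ v 6 < v 3 ∧ v 2 ≤ v 6 ∧ v 3 < v 5 ∧ v 4 ≤ v 3 ∧ v 5 < v 0}

/-- Row insertion of the seventh label bumps `v₃`, `v₄` and `v₀`. -/
def bumpThirdFirstSet : Set (Fin 7 → ℕ) :=
  {v | v ∈ freeSet ∧ v 6 < v 3 ∧ v 2 ≤ v 6 ∧ v 3 < v 4}

/-- Row insertion of the seventh label bumps `v₂`, `v₅` and `v₀`. -/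
def bumpSecondSecondSet : Set (Fin 7 → ℕ) :=
  {v | v ∈ freeSet ∧ v 6 < v 2 ∧ v 1 ≤ v 6 ∧ v 4 ≤ v 2 ∧ v 5 < v 0}

/-- Row insertion of the seventh label bumps `v₂`, `v₄` and `v₀`. -/
def bumpSecondFirstSet : Set (Fin 7 → ℕ) :=
  {v | v ∈ freeSet ∧ v 6 < v 2 ∧ v 1 ≤ v 6 ∧ v 2 < v 4}

/-- Row insertion of the seventh label bumps `v₁`, `v₄` and `v₀`. -/
def bumpFirstFirstSet : Set (Fin 7 → ℕ) := {v | v ∈ freeSet ∧ v 6 < v 1}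

/-- The permutation of `Fin 7` with the given list of values. -/
noncomputable def permOfValues (f : Fin 7 → Fin 7) (hf : Function.Bijective f) :
    Equiv.Perm (Fin 7) := Equiv.ofBijective f hf

theorem tsum_freeSet_eq {W : (Fin 7 → ℕ) → ℂ} (hs : Summable W) :
    ∑' v, freeSet.indicator W v =
      (([fourthColumnSet, thirdColumnSet, bumpSecondAppendThirdSet, bumpThirdAppendThirdSet,
        bumpThirdSecondSet, bumpThirdFirstSet, bumpSecondSecondSet, bumpSecondFirstSet,
        bumpFirstFirstSet] : List (Set (Fin 7 → ℕ))).map fun S => ∑' v, S.indicator W v).sum := by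
  rw [← tsum_indicator_union_eq_sum hs]
  · congr! 3
    ext v
    simp only [List.foldr, Set.mem_union, Set.mem_empty_iff_false, freeSet, fourthColumnSet,
      thirdColumnSet, bumpSecondAppendThirdSet, bumpThirdAppendThirdSet, bumpThirdSecondSet,
      bumpThirdFirstSet, bumpSecondSecondSet, bumpSecondFirstSet, bumpFirstFirstSet,
      Set.mem_ofPred_eq]
    grind
  · simp only [List.pairwise_cons, List.mem_cons, forall_eq_or_imp, List.not_mem_nil, false_imp_iff,
      implies_true, and_true, List.Pairwise.nil, Set.disjoint_left, freeSet,
      fourthColumnSet, thirdColumnSet, bumpSecondAppendThirdSet, bumpThirdAppendThirdSet,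
      bumpThirdSecondSet, bumpThirdFirstSet, bumpSecondSecondSet, bumpSecondFirstSet,
      bumpFirstFirstSet, Set.mem_ofPred_eq]
    and_intros <;> intro v _ _ <;> omega

theorem tsum_secondColumnSet_eq {W : (Fin 7 → ℕ) → ℂ} (hs : Summable W) :
    ∑' v, secondColumnSet.indicator W v =
      (([bumpSecondAppendThirdSet,
        {v | v ∘ permOfValues ![0, 1, 6, 2, 4, 5, 3] (by decide) ∈ bumpThirdAppendThirdSet}] :
        List (Set (Fin 7 → ℕ))).map fun S => ∑' v, S.indicator W v).sum := by
  rw [← tsum_indicator_union_eq_sum hs]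
  · congr! 3
    ext v
    simp only [List.foldr, Set.mem_union, Set.mem_empty_iff_false, freeSet, secondColumnSet,
      bumpSecondAppendThirdSet, bumpThirdAppendThirdSet, Set.mem_ofPred_eq, permOfValues,
      Function.comp_apply, Equiv.ofBijective_apply, Matrix.cons_val]
    grind
  · simp only [List.pairwise_cons, List.mem_cons, forall_eq_or_imp, List.not_mem_nil, false_imp_iff,
      implies_true, and_true, List.Pairwise.nil, Set.disjoint_left, freeSet,
      bumpSecondAppendThirdSet, bumpThirdAppendThirdSet, Set.mem_ofPred_eq, permOfValues,
      Function.comp_apply, Equiv.ofBijective_apply, Matrix.cons_val]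
    intro v _ _
    omega

theorem tsum_firstColumnSet_eq {W : (Fin 7 → ℕ) → ℂ} (hs : Summable W) :
    ∑' v, firstColumnSet.indicator W v =
      (([{v | v ∘ permOfValues ![0, 6, 2, 5, 1, 4, 3] (by decide) ∈ bumpThirdSecondSet},
        {v | v ∘ permOfValues ![0, 6, 2, 1, 4, 5, 3] (by decide) ∈ bumpThirdFirstSet},
        {v | v ∘ permOfValues ![0, 6, 5, 3, 1, 4, 2] (by decide) ∈ bumpSecondSecondSet},
        {v | v ∘ permOfValues ![0, 6, 1, 3, 4, 5, 2] (by decide) ∈ bumpSecondFirstSet},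
        bumpFirstFirstSet] :
        List (Set (Fin 7 → ℕ))).map fun S => ∑' v, S.indicator W v).sum := by
  rw [← tsum_indicator_union_eq_sum hs]
  · congr! 3
    ext v
    simp only [List.foldr, Set.mem_union, Set.mem_empty_iff_false, freeSet, firstColumnSet,
      bumpThirdSecondSet, bumpThirdFirstSet, bumpSecondSecondSet, bumpSecondFirstSet,
      bumpFirstFirstSet, Set.mem_ofPred_eq, permOfValues,
      Function.comp_apply, Equiv.ofBijective_apply, Matrix.cons_val]
    grind
  · simp only [List.pairwise_cons, List.mem_cons, forall_eq_or_imp, List.not_mem_nil, false_imp_iff,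
      implies_true, and_true, List.Pairwise.nil, Set.disjoint_left, freeSet,
      bumpThirdSecondSet, bumpThirdFirstSet, bumpSecondSecondSet, bumpSecondFirstSet,
      bumpFirstFirstSet, Set.mem_ofPred_eq, permOfValues,
      Function.comp_apply, Equiv.ofBijective_apply, Matrix.cons_val]
    and_intros <;> intro v _ _ <;> omega

theorem tsum_freeSet_indicator {W : (Fin 7 → ℕ) → ℂ} (hs : Summable W)
    (hW : ∀ π : Equiv.Perm (Fin 7), π 0 = 0 → ∀ v, W (v ∘ π) = W v) :
    ∑' v, freeSet.indicator W v =
      ∑' v, firstColumnSet.indicator W v + ∑' v, secondColumnSet.indicator W v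
      + ∑' v, thirdColumnSet.indicator W v + ∑' v, fourthColumnSet.indicator W v := by
  rw [tsum_freeSet_eq hs, tsum_firstColumnSet_eq hs, tsum_secondColumnSet_eq hs]
  simp only [List.map_cons, List.map_nil, List.sum_cons, List.sum_nil]
  rw [← tsum_indicator_comp _ (hW _ rfl), ← tsum_indicator_comp _ (hW _ rfl),
    ← tsum_indicator_comp _ (hW _ rfl), ← tsum_indicator_comp _ (hW _ rfl),
    ← tsum_indicator_comp _ (hW _ rfl)]
  ring

theorem sum_tsum_indicator {n : ℕ} (s : ℂ) (a : Fin n → ℂ) (hs : 1 < s.re)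
    (ha : ∀ i, 1 < (a i).re) (S : Set (Fin (n + 1) → ℕ)) :
    ∑ σ : Equiv.Perm (Fin n), ∑' v, S.indicator (zetaTerm (Fin.cons s (a ∘ σ))) v =
      ∑' v, S.indicator (symmTerm s a) v := by
  rw [← Summable.tsum_finsetSum fun σ _ => (summable_zetaTerm_cons s a hs ha σ).indicator S]
  refine tsum_congr fun v => ?_
  by_cases hv : v ∈ S <;> simp [hv, symmTerm]

/-- the Pieri-type formula for the shape `(3,2,1)`, symmetrized over all
`720` orderings of the tuple `(s₁₁, s₁₂, s₁₃, s₂₁, s₂₂, z)`. -/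
theorem stmt13 (s11 s12 s13 s21 s22 s31 z : ℂ)
    (h11 : 1 < s11.re) (h12 : 1 < s12.re) (h13 : 1 < s13.re) (h21 : 1 < s21.re)
    (h22 : 1 < s22.re) (h31 : 1 < s31.re) (hz : 1 < z.re) :
    ∑ σ : Equiv.Perm (Fin 6),
      F13 s31 (![s11, s12, s13, s21, s22, z] (σ 0)) (![s11, s12, s13, s21, s22, z] (σ 1))
        (![s11, s12, s13, s21, s22, z] (σ 2)) (![s11, s12, s13, s21, s22, z] (σ 3))
        (![s11, s12, s13, s21, s22, z] (σ 4)) (![s11, s12, s13, s21, s22, z] (σ 5))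
    = ∑ σ : Equiv.Perm (Fin 6),
        G13 s31 (![s11, s12, s13, s21, s22, z] (σ 0)) (![s11, s12, s13, s21, s22, z] (σ 1))
          (![s11, s12, s13, s21, s22, z] (σ 2)) (![s11, s12, s13, s21, s22, z] (σ 3))
          (![s11, s12, s13, s21, s22, z] (σ 4)) (![s11, s12, s13, s21, s22, z] (σ 5)) := by
  set a : Fin 6 → ℂ := ![s11, s12, s13, s21, s22, z]
  have ha : ∀ i, 1 < (a i).re := by
    simp [a, Fin.forall_fin_succ, *]
  have key (σ : Equiv.Perm (Fin 6)) :
      ![s31, a (σ 0), a (σ 1), a (σ 2), a (σ 3), a (σ 4), a (σ 5)] = Fin.cons s31 (a ∘ σ) := by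
    funext i
    fin_cases i <;> rfl
  have hF (σ : Equiv.Perm (Fin 6)) := F13_eq_tsum s31 (a (σ 0)) (a (σ 1)) (a (σ 2)) (a (σ 3))
    (a (σ 4)) (a (σ 5)) (by simp [Fin.forall_fin_succ, h31, ha])
  simp only [hF, G13_eq_tsum, key, Finset.sum_add_distrib, sum_tsum_indicator s31 a h31 ha]
  exact tsum_freeSet_indicator (summable_sum fun σ _ => summable_zetaTerm_cons s31 a h31 ha σ)
    fun π hπ v => symmTerm_comp s31 a π hπ v
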